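/- Let φ(x) = (2π)^(−1/2) exp(−x²/2) denote the standard normal density and Φ(x) = ∫_{−∞}^x φ(t) dt the standard normal CDF. Fix σ > 0, λ > 0, a natural number t ≥ 1, a vector ψ ∈ ℝ^d, and thresholds a < b. Then the regularized per-entry Probit loss u ↦ −log( Φ((b − ⟨u, ψ⟩)/σ) − Φ((a − ⟨u, ψ⟩)/σ) ) + (λ/(2t))‖u‖² is (λ/t)-strongly convex on ℝ^d. (Probit part of the bi-convexity Lemma: the per-entry regularized loss is convex in each block variable.) -/

import Mathlib

open MeasureTheory RealInnerProductSpace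

/-- The standard normal density `φ(x) = (2π)^(−1/2) exp(−x²/2)`. -/
noncomputable def stdNormalPDF (x : ℝ) : ℝ :=
  (Real.sqrt (2 * Real.pi))⁻¹ * Real.exp (-x ^ 2 / 2)

/-- The standard normal CDF `Φ(x) = ∫_{−∞}^x φ(t) dt`. -/
noncomputable def stdNormalCDF (x : ℝ) : ℝ :=
  ∫ t in Set.Iic x, stdNormalPDF t

theorem stdNormalPDF_pos (x : ℝ) : 0 < stdNormalPDF x := by
  unfold stdNormalPDF
  positivity

theorem hasDerivAt_stdNormalPDF (x : ℝ) :
    HasDerivAt stdNormalPDF (-x * stdNormalPDF x) x := by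
  unfold stdNormalPDF
  have h : HasDerivAt (fun y : ℝ => -y ^ 2 / 2) (-x) x := by
    refine ((hasDerivAt_pow 2 x).neg.div_const 2).congr_deriv ?_
    norm_num
    ring
  exact (h.exp.const_mul _).congr_deriv (by ring)

theorem continuous_stdNormalPDF : Continuous stdNormalPDF := by
  unfold stdNormalPDF
  fun_prop

theorem integrable_stdNormalPDF : Integrable stdNormalPDF := by
  have h := (integrable_exp_neg_mul_sq (b := 1 / 2) (by norm_num)).const_mul
    (Real.sqrt (2 * Real.pi))⁻¹
  refine h.congr (.of_forall fun x => ?_)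
  simp only [stdNormalPDF]
  ring_nf

theorem stdNormalCDF_sub (x y : ℝ) :
    stdNormalCDF y - stdNormalCDF x = ∫ t in x..y, stdNormalPDF t :=
  intervalIntegral.integral_Iic_sub_Iic integrable_stdNormalPDF.integrableOn
    integrable_stdNormalPDF.integrableOn

theorem hasDerivAt_stdNormalCDF (x : ℝ) : HasDerivAt stdNormalCDF (stdNormalPDF x) x := by
  have h : stdNormalCDF = fun y => (∫ t in (0 : ℝ)..y, stdNormalPDF t) + stdNormalCDF 0 := by
    funext y
    rw [← stdNormalCDF_sub, sub_add_cancel]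
  rw [h]
  exact (continuous_stdNormalPDF.integral_hasStrictDerivAt 0 x).hasDerivAt.add_const _

theorem stdNormalCDF_sub_pos {x y : ℝ} (hxy : x < y) : 0 < stdNormalCDF y - stdNormalCDF x := by
  rw [stdNormalCDF_sub]
  exact intervalIntegral.intervalIntegral_pos_of_pos
    (continuous_stdNormalPDF.intervalIntegrable _ _) stdNormalPDF_pos hxy

/-- The first moment of the standard normal distribution over an interval. -/
theorem integral_mul_stdNormalPDF (x y : ℝ) :
    ∫ t in x..y, t * stdNormalPDF t = stdNormalPDF x - stdNormalPDF y := by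
  have hint : IntervalIntegrable (fun t => t * stdNormalPDF t) volume x y :=
    (continuous_id.mul continuous_stdNormalPDF).intervalIntegrable _ _
  rw [intervalIntegral.integral_eq_sub_of_hasDerivAt (f := fun t => -stdNormalPDF t)
    (fun t _ => (hasDerivAt_stdNormalPDF t).neg.congr_deriv (by ring)) hint]
  ring

theorem mul_stdNormalCDF_sub_le {x y : ℝ} (hxy : x ≤ y) :
    x * (stdNormalCDF y - stdNormalCDF x) ≤ stdNormalPDF x - stdNormalPDF y := by
  rw [stdNormalCDF_sub, ← integral_mul_stdNormalPDF, ← intervalIntegral.integral_const_mul]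
  exact intervalIntegral.integral_mono_on hxy
    ((continuous_stdNormalPDF.const_mul x).intervalIntegrable _ _)
    ((continuous_id.mul continuous_stdNormalPDF).intervalIntegrable _ _)
    fun t ht => mul_le_mul_of_nonneg_right ht.1 (stdNormalPDF_pos t).le

theorem le_mul_stdNormalCDF_sub {x y : ℝ} (hxy : x ≤ y) :
    stdNormalPDF x - stdNormalPDF y ≤ y * (stdNormalCDF y - stdNormalCDF x) := by
  rw [stdNormalCDF_sub, ← integral_mul_stdNormalPDF, ← intervalIntegral.integral_const_mul]
  exact intervalIntegral.integral_mono_on hxy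
    ((continuous_id.mul continuous_stdNormalPDF).intervalIntegrable _ _)
    ((continuous_stdNormalPDF.const_mul y).intervalIntegrable _ _)
    fun t ht => mul_le_mul_of_nonneg_right ht.2 (stdNormalPDF_pos t).le

/-- The standard normal mass of a translated interval is log-concave in the translation. -/
theorem convexOn_neg_log_stdNormalCDF_add_sub {c : ℝ} (hc : 0 < c) :
    ConvexOn ℝ Set.univ (fun x => -Real.log (stdNormalCDF (x + c) - stdNormalCDF x)) := by
  have hpos (x : ℝ) : 0 < stdNormalCDF (x + c) - stdNormalCDF x :=
    stdNormalCDF_sub_pos (lt_add_of_pos_right x hc)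
  have hG (x : ℝ) : HasDerivAt (fun x => stdNormalCDF (x + c) - stdNormalCDF x)
      (stdNormalPDF (x + c) - stdNormalPDF x) x :=
    ((hasDerivAt_stdNormalCDF (x + c)).comp_add_const x c).sub (hasDerivAt_stdNormalCDF x)
  have hg (x : ℝ) : HasDerivAt (fun x => stdNormalPDF (x + c) - stdNormalPDF x)
      (-(x + c) * stdNormalPDF (x + c) - -x * stdNormalPDF x) x :=
    ((hasDerivAt_stdNormalPDF (x + c)).comp_add_const x c).sub (hasDerivAt_stdNormalPDF x)
  have hlog (x : ℝ) := ((hG x).log (hpos x).ne').neg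
  have hlog' (x : ℝ) := ((hg x).div (hG x) (hpos x).ne').neg
  refine convexOn_of_hasDerivWithinAt2_nonneg convex_univ
    (fun x _ => (hlog x).continuousAt.continuousWithinAt)
    (fun x _ => (hlog x).hasDerivWithinAt) (fun x _ => (hlog' x).hasDerivWithinAt) fun x _ => ?_
  rw [← neg_div]
  refine div_nonneg ?_ (sq_nonneg _)
  have hxc : x ≤ x + c := by linarith
  have h₁ := mul_nonneg (stdNormalPDF_pos x).le (sub_nonneg.2 (mul_stdNormalCDF_sub_le hxc))
  have h₂ := mul_nonneg (stdNormalPDF_pos (x + c)).le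
    (sub_nonneg.2 (le_mul_stdNormalCDF_sub hxc))
  linear_combination h₁ + h₂

/-- The regularized per-entry Probit loss
`u ↦ −log(Φ((b − ⟨u, ψ⟩)/σ) − Φ((a − ⟨u, ψ⟩)/σ)) + (λ/(2t))‖u‖²`
is `(λ/t)`-strongly convex on `ℝ^d`. -/
theorem probit_per_entry_loss_strongly_convex {d : ℕ} (σ lam : ℝ) (hσ : 0 < σ)
    (hlam : 0 < lam) (t : ℕ) (ht : 1 ≤ t) (ψ : EuclideanSpace ℝ (Fin d)) (a b : ℝ)
    (hab : a < b) :
    ConvexOn ℝ Set.univ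
      (fun u : EuclideanSpace ℝ (Fin d) =>
        (-Real.log (stdNormalCDF ((b - ⟪u, ψ⟫) / σ) - stdNormalCDF ((a - ⟪u, ψ⟫) / σ))
            + (lam / (2 * t)) * ‖u‖ ^ 2)
          - (lam / t / 2) * ‖u‖ ^ 2) := by
  have hline (u : EuclideanSpace ℝ (Fin d)) :
      (b - ⟪u, ψ⟫) / σ = (a - ⟪u, ψ⟫) / σ + (b - a) / σ := by ring
  have hloss := convexOn_neg_log_stdNormalCDF_add_sub (div_pos (sub_pos.2 hab) hσ)
  refine ⟨convex_univ, fun u _ v _ p q hp hq hpq => ?_⟩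
  have h := hloss.2 (Set.mem_univ ((a - ⟪u, ψ⟫) / σ)) (Set.mem_univ ((a - ⟪v, ψ⟫) / σ)) hp hq hpq
  have haff : p • ((a - ⟪u, ψ⟫) / σ) + q • ((a - ⟪v, ψ⟫) / σ) =
      (a - ⟪p • u + q • v, ψ⟫) / σ := by
    rw [inner_add_left, real_inner_smul_left, real_inner_smul_left, smul_eq_mul, smul_eq_mul]
    linear_combination a / σ * hpq
  rw [haff] at h
  have hreg (r x : ℝ) : r + lam / (2 * t) * x - lam / t / 2 * x = r := by ring
  simpa only [hline, hreg] using h
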